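/- There exists a finite constant C (depending only on l) such that for all a, a' ≥ 0 and all b, b' ∈ ℝ, |Γ(a,b) − Γ(a',b')| ≤ C·(|b' − b| + |a' − a| + |√a' − √a|). -/

import Mathlib

noncomputable def Phi (x : ℝ) : ℝ :=
  (Real.sqrt (2 * Real.pi))⁻¹ * ∫ y in Set.Iic x, Real.exp (-y ^ 2 / 2)

/-- The function `Γ` from the paper (depending on the parameter `l`). -/
noncomputable def Gam (l a b : ℝ) : ℝ :=
  if 0 < a then
    l ^ 2 * Phi (-(l * b) / (2 * Real.sqrt a))
      + l ^ 2 * Real.exp (l ^ 2 * (a - b) / 2) * Phi (l * (b / (2 * Real.sqrt a) - Real.sqrt a))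
  else l ^ 2 * Real.exp (-(l ^ 2 * max b 0) / 2)

/-- The function `𝒢` from the paper (depending on the parameter `l`). -/
noncomputable def Gcal (l a b : ℝ) : ℝ :=
  if 0 < a then
    l ^ 2 * Real.exp (l ^ 2 * (a - b) / 2) * Phi (l * (b / (2 * Real.sqrt a) - Real.sqrt a))
  else if 0 < b then l ^ 2 * Real.exp (-(l ^ 2 * b) / 2) else 0

open MeasureTheory Set

lemma integrable_exp_neg_sq_div_two : Integrable fun z : ℝ => Real.exp (-z ^ 2 / 2) := by
  refine (integrable_exp_neg_mul_sq (b := 1 / 2) (by norm_num)).congr (.of_forall fun z => ?_)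
  ring_nf

lemma integrable_abs_mul_exp_neg_sq_div_two :
    Integrable fun z : ℝ => |z| * Real.exp (-z ^ 2 / 2) := by
  refine (integrable_mul_exp_neg_mul_sq (b := 1 / 2) (by norm_num)).abs.congr
    (.of_forall fun z => ?_)
  simp only [abs_mul, Real.abs_exp]
  ring_nf

lemma integral_exp_neg_sq_div_two :
    ∫ z : ℝ, Real.exp (-z ^ 2 / 2) = Real.sqrt (2 * Real.pi) := by
  have h := integral_gaussian (1 / 2)
  rw [show Real.pi / (1 / 2) = 2 * Real.pi by ring] at h
  rw [← h]
  congr 1 with z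
  ring_nf

lemma integral_Ioi_exp_neg_add_sq_div_two (c s : ℝ) :
    ∫ z in Ioi c, Real.exp (-(z + s) ^ 2 / 2) =
      ∫ z in Iic (-(c + s)), Real.exp (-z ^ 2 / 2) := by
  have h := (measurePreserving_add_right volume s).setIntegral_preimage_emb
    (MeasurableEquiv.addRight s).measurableEmbedding
    (fun z : ℝ => Real.exp (-z ^ 2 / 2)) (Ioi (c + s))
  rw [preimage_add_const_Ioi, add_sub_cancel_right] at h
  rw [h, ← integral_comp_neg_Ioi]
  simp only [neg_sq]

lemma abs_exp_neg_max_sub_le (x y : ℝ) :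
    |Real.exp (-max 0 x) - Real.exp (-max 0 y)| ≤ |x - y| := by
  wlog h : x ≤ y generalizing x y
  · rw [abs_sub_comm, abs_sub_comm x]
    exact this y x (le_of_not_ge h)
  have hmax : max 0 x ≤ max 0 y := max_le_max_left 0 h
  have hexp : Real.exp (-max 0 y) ≤ Real.exp (-max 0 x) := Real.exp_le_exp.2 (neg_le_neg hmax)
  have hle : Real.exp (-max 0 x) ≤ 1 := Real.exp_le_one_iff.2 (by simp)
  have hdiff : max 0 y - max 0 x ≤ y - x := by
    rcases max_cases 0 x with hx | hx <;> rcases max_cases 0 y with hy | hy <;> linarith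
  have hfac : Real.exp (-max 0 y) =
      Real.exp (-max 0 x) * Real.exp (-(max 0 y - max 0 x)) := by
    rw [← Real.exp_add]; ring_nf
  have hlin := Real.add_one_le_exp (-(max 0 y - max 0 x))
  have hpos := Real.exp_pos (-max 0 x)
  rw [abs_of_nonneg (by linarith), abs_of_nonpos (by linarith), hfac]
  nlinarith

lemma integrable_exp_neg_max_mul_gaussian (m s : ℝ) :
    Integrable fun z : ℝ => Real.exp (-max 0 (m + s * z)) * Real.exp (-z ^ 2 / 2) := by
  refine integrable_exp_neg_sq_div_two.bdd_mul (c := 1)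
    (Continuous.aestronglyMeasurable (by fun_prop)) (.of_forall fun z => ?_)
  rw [Real.norm_eq_abs, Real.abs_exp]
  exact Real.exp_le_one_iff.2 (by simp)

lemma integral_exp_neg_max_mul_gaussian (m : ℝ) {s : ℝ} (hs : 0 < s) :
    ∫ z : ℝ, Real.exp (-max 0 (m + s * z)) * Real.exp (-z ^ 2 / 2) =
      (∫ z in Iic (-m / s), Real.exp (-z ^ 2 / 2)) +
        Real.exp (s ^ 2 / 2 - m) * ∫ z in Iic (m / s - s), Real.exp (-z ^ 2 / 2) := by
  have hint := integrable_exp_neg_max_mul_gaussian m s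
  rw [← intervalIntegral.integral_Iic_add_Ioi (b := -m / s) hint.integrableOn hint.integrableOn]
  congr 1
  · refine setIntegral_congr_fun measurableSet_Iic fun z hz => ?_
    have hz' : m + s * z ≤ 0 := by
      have := (le_div_iff₀ hs).1 (mem_Iic.1 hz)
      linarith
    simp [max_eq_left hz']
  · rw [show m / s - s = -(-m / s + s) by ring, ← integral_Ioi_exp_neg_add_sq_div_two,
      ← integral_const_mul]
    refine setIntegral_congr_fun measurableSet_Ioi fun z hz => ?_
    have hz' : 0 ≤ m + s * z := by
      have := (div_lt_iff₀ hs).1 (mem_Ioi.1 hz)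
      linarith
    simp only [max_eq_right hz', ← Real.exp_add]
    ring_nf

/-- `Γ(a, b) = l² E[exp (-max (0, l² b / 2 + l √a Z))]` for a standard Gaussian `Z`. -/
lemma Gam_eq_integral {l a : ℝ} (hl : 0 < l) (ha : 0 ≤ a) (b : ℝ) :
    Gam l a b = l ^ 2 * (Real.sqrt (2 * Real.pi))⁻¹ *
      ∫ z : ℝ, Real.exp (-max 0 (l ^ 2 * b / 2 + l * Real.sqrt a * z)) *
        Real.exp (-z ^ 2 / 2) := by
  rcases ha.eq_or_lt with rfl | ha
  · have hpi : Real.sqrt (2 * Real.pi) ≠ 0 := by positivity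
    have hmax : max 0 (l ^ 2 * b / 2) = l ^ 2 * max b 0 / 2 := by
      rw [max_comm b, mul_div_right_comm, mul_div_right_comm, mul_max_of_nonneg _ _ (by positivity),
        mul_zero]
    simp only [Gam, lt_irrefl, if_false, Real.sqrt_zero, mul_zero, zero_mul, add_zero,
      integral_const_mul, integral_exp_neg_sq_div_two, hmax]
    field_simp
  · have hs : 0 < Real.sqrt a := Real.sqrt_pos.2 ha
    rw [integral_exp_neg_max_mul_gaussian _ (mul_pos hl hs), Gam, if_pos ha, Phi, Phi,
      show -(l ^ 2 * b / 2) / (l * Real.sqrt a) = -(l * b) / (2 * Real.sqrt a) by field_simp,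
      show l ^ 2 * b / 2 / (l * Real.sqrt a) - l * Real.sqrt a =
        l * (b / (2 * Real.sqrt a) - Real.sqrt a) by field_simp,
      show (l * Real.sqrt a) ^ 2 / 2 - l ^ 2 * b / 2 = l ^ 2 * (a - b) / 2 by
        rw [mul_pow, Real.sq_sqrt ha.le]; ring]
    ring

lemma abs_integral_exp_neg_max_sub_le (m m' s s' : ℝ) :
    |(∫ z : ℝ, Real.exp (-max 0 (m + s * z)) * Real.exp (-z ^ 2 / 2)) -
        ∫ z : ℝ, Real.exp (-max 0 (m' + s' * z)) * Real.exp (-z ^ 2 / 2)| ≤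
      |m - m'| * (∫ z : ℝ, Real.exp (-z ^ 2 / 2)) +
        |s - s'| * ∫ z : ℝ, |z| * Real.exp (-z ^ 2 / 2) := by
  rw [← integral_sub (integrable_exp_neg_max_mul_gaussian m s)
    (integrable_exp_neg_max_mul_gaussian m' s'), ← integral_const_mul, ← integral_const_mul,
    ← integral_add (integrable_exp_neg_sq_div_two.const_mul _)
      (integrable_abs_mul_exp_neg_sq_div_two.const_mul _), ← Real.norm_eq_abs]
  refine norm_integral_le_of_norm_le ((integrable_exp_neg_sq_div_two.const_mul _).add
      (integrable_abs_mul_exp_neg_sq_div_two.const_mul _)) (.of_forall fun z => ?_)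
  rw [Real.norm_eq_abs, ← sub_mul, abs_mul, Real.abs_exp, ← mul_assoc, ← add_mul]
  gcongr
  calc _ ≤ |m + s * z - (m' + s' * z)| := abs_exp_neg_max_sub_le _ _
    _ = |(m - m') + (s - s') * z| := by ring_nf
    _ ≤ |m - m'| + |s - s'| * |z| := by rw [← abs_mul]; exact abs_add_le _ _

theorem stmt_3 (l : ℝ) (hl : 0 < l) :
    ∃ C : ℝ, ∀ a a' : ℝ, 0 ≤ a → 0 ≤ a' → ∀ b b' : ℝ,
      |Gam l a b - Gam l a' b'| ≤
        C * (|b' - b| + |a' - a| + |Real.sqrt a' - Real.sqrt a|) := by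
  set I₀ := ∫ z : ℝ, Real.exp (-z ^ 2 / 2)
  set I₁ := ∫ z : ℝ, |z| * Real.exp (-z ^ 2 / 2)
  have hI₀ : 0 ≤ I₀ := integral_nonneg fun z => by positivity
  have hI₁ : 0 ≤ I₁ := integral_nonneg fun z => by positivity
  refine ⟨l ^ 2 * (Real.sqrt (2 * Real.pi))⁻¹ * (l ^ 2 / 2 * I₀ + l * I₁),
    fun a a' ha ha' b b' => ?_⟩
  rw [Gam_eq_integral hl ha, Gam_eq_integral hl ha', ← mul_sub, abs_mul,
    abs_of_nonneg (by positivity : 0 ≤ l ^ 2 * (Real.sqrt (2 * Real.pi))⁻¹), mul_assoc _ (_ + _)]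
  gcongr
  refine (abs_integral_exp_neg_max_sub_le _ _ _ _).trans ?_
  have hb : |l ^ 2 * b / 2 - l ^ 2 * b' / 2| = l ^ 2 / 2 * |b' - b| := by
    rw [abs_sub_comm b', ← abs_of_nonneg (by positivity : 0 ≤ l ^ 2 / 2), ← abs_mul]
    ring_nf
  have hs : |l * Real.sqrt a - l * Real.sqrt a'| = l * |Real.sqrt a' - Real.sqrt a| := by
    rw [abs_sub_comm (Real.sqrt a'), ← mul_sub, abs_mul, abs_of_pos hl]
  rw [hb, hs]
  calc l ^ 2 / 2 * |b' - b| * I₀ + l * |Real.sqrt a' - Real.sqrt a| * I₁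
      = l ^ 2 / 2 * I₀ * |b' - b| + l * I₁ * |Real.sqrt a' - Real.sqrt a| := by ring
    _ ≤ l ^ 2 / 2 * I₀ * (|b' - b| + |a' - a| + |Real.sqrt a' - Real.sqrt a|) +
        l * I₁ * (|b' - b| + |a' - a| + |Real.sqrt a' - Real.sqrt a|) := by
      have := abs_nonneg (b' - b)
      have := abs_nonneg (a' - a)
      have := abs_nonneg (Real.sqrt a' - Real.sqrt a)
      gcongr <;> linarith
    _ = _ := by ring
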